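/- The SAF invariant is a homomorphism from the group of interval exchange transformations of [0,1) to the additive group of ℝ ⊗_ℚ ℝ: if f and g are IETs of [0,1), then f ∘ g is an IET of [0,1), and for any presenting data of f, of g, and of f ∘ g, the corresponding sums satisfy Inv(f ∘ g) = Inv(f) + Inv(g) in ℝ ⊗_ℚ ℝ (in particular, Inv(f) does not depend on the choice of presenting data for f). -/

import Mathlib

open scoped TensorProduct

noncomputable section

/-- `(n, c, t)` is presenting data for the interval exchange transformation `f` of `[0,1)`:
`0 = c 0 < c 1 < ⋯ < c n = 1`, the map `f` is a bijection of `[0,1)`, and `f x = x + t i`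
on each interval `[c i, c (i+1))`, `i = 0, …, n - 1`. -/
def IsIETData (f : ℝ → ℝ) (n : ℕ) (c t : ℕ → ℝ) : Prop :=
  0 < n ∧ c 0 = 0 ∧ c n = 1 ∧ (∀ i < n, c i < c (i + 1)) ∧
  Set.BijOn f (Set.Ico 0 1) (Set.Ico 0 1) ∧
  ∀ i < n, ∀ x ∈ Set.Ico (c i) (c (i + 1)), f x = x + t i

/-- The Sah–Arnoux–Fathi invariant of the presenting data `(n, c, t)`:
`Σ_{i} (c (i+1) - c i) ⊗ t i ∈ ℝ ⊗_ℚ ℝ`. -/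
noncomputable def SAF (n : ℕ) (c t : ℕ → ℝ) : ℝ ⊗[ℚ] ℝ :=
  ∑ i ∈ Finset.range n, (c (i + 1) - c i) ⊗ₜ[ℚ] t i

open MeasureTheory

theorem measureReal_eq_sum_inter {μ : Measure ℝ} {n : ℕ} {U : ℕ → Set ℝ} {S : Set ℝ}
    (hU : ∀ i < n, MeasurableSet (U i)) (hS : MeasurableSet S) (hfin : μ S ≠ ⊤)
    (hdisj : ∀ i < n, ∀ j < n, ∀ x ∈ U i, x ∈ U j → i = j)
    (hcover : ∀ x ∈ S, ∃ i < n, x ∈ U i) :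
    μ.real S = ∑ i ∈ Finset.range n, μ.real (S ∩ U i) := by
  rw [← measureReal_biUnion_finset]
  · congr 1
    ext x
    simp only [Finset.mem_range, Set.mem_iUnion, Set.mem_inter_iff, exists_prop]
    exact ⟨fun hx => (hcover x hx).imp fun i hi => ⟨hi.1, hx, hi.2⟩,
      fun ⟨_, _, hx, _⟩ => hx⟩
  · intro i hi j hj hij
    rw [Function.onFun, Set.disjoint_left]
    rintro x ⟨_, hxi⟩ ⟨_, hxj⟩
    exact hij (hdisj i (by simpa using hi) j (by simpa using hj) x hxi hxj)
  · exact fun i hi => hS.inter (hU i (by simpa using hi))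

namespace IsIETData

variable {f : ℝ → ℝ} {n : ℕ} {c t : ℕ → ℝ}

theorem endpoint_mono (h : IsIETData f n c t) {i j : ℕ} (hij : i ≤ j) (hj : j ≤ n) :
    c i ≤ c j := by
  obtain ⟨-, -, -, hc, -, -⟩ := h
  induction j, hij using Nat.le_induction with
  | base => rfl
  | succ k _ ih => exact (ih (by omega)).trans (hc k (by omega)).le

theorem Ico_subset (h : IsIETData f n c t) {i : ℕ} (hi : i < n) :
    Set.Ico (c i) (c (i + 1)) ⊆ Set.Ico 0 1 := by
  have h0 := h.endpoint_mono (Nat.zero_le i) hi.le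
  have h1 := h.endpoint_mono (Nat.succ_le_of_lt hi) le_rfl
  rw [h.2.1] at h0
  rw [h.2.2.1] at h1
  exact Set.Ico_subset_Ico h0 h1

theorem exists_mem_Ico (h : IsIETData f n c t) {x : ℝ} (hx : x ∈ Set.Ico (0 : ℝ) 1) :
    ∃ i < n, x ∈ Set.Ico (c i) (c (i + 1)) := by
  obtain ⟨-, h0, h1, -, -, -⟩ := h
  have hex : ∃ k, x < c k := ⟨n, h1 ▸ hx.2⟩
  classical
  have hle : Nat.find hex ≤ n := Nat.find_min' hex (h1 ▸ hx.2)
  have hlt : x < c (Nat.find hex) := Nat.find_spec hex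
  obtain ⟨k, hk⟩ : ∃ k, Nat.find hex = k + 1 := by
    refine Nat.exists_eq_succ_of_ne_zero fun h => ?_
    rw [h, h0] at hlt
    exact hlt.not_ge hx.1
  refine ⟨k, by omega, not_lt.1 (Nat.find_min hex (by omega)), hk ▸ hlt⟩

theorem index_unique (h : IsIETData f n c t) {i j : ℕ} (hi : i < n) (hj : j < n) {x : ℝ}
    (hxi : x ∈ Set.Ico (c i) (c (i + 1))) (hxj : x ∈ Set.Ico (c j) (c (j + 1))) : i = j := by
  rcases lt_trichotomy i j with hij | hij | hij
  · linarith [h.endpoint_mono (Nat.succ_le_of_lt hij) hj.le, hxi.2, hxj.1]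
  · exact hij
  · linarith [h.endpoint_mono (Nat.succ_le_of_lt hij) hi.le, hxj.2, hxi.1]

theorem volumeReal_eq_sum (h : IsIETData f n c t) {S : Set ℝ} (hS : MeasurableSet S)
    (hsub : S ⊆ Set.Ico 0 1) :
    volume.real S = ∑ i ∈ Finset.range n, volume.real (S ∩ Set.Ico (c i) (c (i + 1))) :=
  measureReal_eq_sum_inter (fun _ _ => measurableSet_Ico) hS
    (measure_ne_top_of_subset hsub measure_Ico_lt_top.ne)
    (fun _ hi _ hj _ hxi hxj => h.index_unique hi hj hxi hxj)
    fun _ hx => h.exists_mem_Ico (hsub hx)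

theorem inter_preimage_eq (h : IsIETData f n c t) {i : ℕ} (hi : i < n) (S : Set ℝ) :
    Set.Ico (c i) (c (i + 1)) ∩ f ⁻¹' S =
      Set.Ico (c i) (c (i + 1)) ∩ (fun x => x + t i) ⁻¹' S := by
  ext x
  refine and_congr_right fun hx => ?_
  rw [Set.mem_preimage, Set.mem_preimage, h.2.2.2.2.2 i hi x hx]

theorem measurableSet_inter_preimage (h : IsIETData f n c t) {S : Set ℝ}
    (hS : MeasurableSet S) : MeasurableSet (Set.Ico 0 1 ∩ f ⁻¹' S) := by
  have : Set.Ico 0 1 ∩ f ⁻¹' S =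
      ⋃ i ∈ Finset.range n, Set.Ico (c i) (c (i + 1)) ∩ f ⁻¹' S := by
    ext x
    simp only [Finset.mem_range, Set.mem_iUnion, exists_prop]
    constructor
    · rintro ⟨hx, hxS⟩
      exact (h.exists_mem_Ico hx).imp fun i hi => ⟨hi.1, hi.2, hxS⟩
    · rintro ⟨i, hi, hx, hxS⟩
      exact ⟨h.Ico_subset hi hx, hxS⟩
  rw [this]
  refine Finset.measurableSet_biUnion _ fun i hi => ?_
  rw [h.inter_preimage_eq (Finset.mem_range.1 hi)]
  exact measurableSet_Ico.inter (measurable_add_const (t i) hS)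

/-- An interval exchange transformation preserves Lebesgue measure. -/
theorem volumeReal_inter_preimage (h : IsIETData f n c t) {S : Set ℝ}
    (hS : MeasurableSet S) (hsub : S ⊆ Set.Ico 0 1) :
    volume.real (Set.Ico 0 1 ∩ f ⁻¹' S) = volume.real S := by
  have hbij := h.2.2.2.2.1
  have htr := h.2.2.2.2.2
  have hval : ∀ i < n, ∀ y ∈ (fun x => x + -t i) ⁻¹' Set.Ico (c i) (c (i + 1)),
      f (y + -t i) = y := fun i hi y hy => by
    rw [htr i hi _ hy]; ring
  rw [h.volumeReal_eq_sum (h.measurableSet_inter_preimage hS) Set.inter_subset_left,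
    measureReal_eq_sum_inter (n := n)
      (U := fun i => (fun x => x + -t i) ⁻¹' Set.Ico (c i) (c (i + 1)))
      (fun i _ => measurable_add_const (-t i) measurableSet_Ico) hS
      (measure_ne_top_of_subset hsub measure_Ico_lt_top.ne)]
  · refine Finset.sum_congr rfl fun i hi => ?_
    rw [Finset.mem_range] at hi
    have h1 : Set.Ico 0 1 ∩ f ⁻¹' S ∩ Set.Ico (c i) (c (i + 1)) =
        (fun x => x + t i) ⁻¹' (S ∩ (fun x => x + -t i) ⁻¹' Set.Ico (c i) (c (i + 1))) := by
      rw [Set.inter_right_comm, Set.inter_eq_self_of_subset_right (h.Ico_subset hi),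
        h.inter_preimage_eq hi]
      ext x
      simp [and_comm]
    rw [h1, measureReal_def, measure_preimage_add_right, ← measureReal_def]
  · intro i hi j hj y hyi hyj
    have heq : y + -t i = y + -t j :=
      hbij.injOn (h.Ico_subset hi hyi) (h.Ico_subset hj hyj)
        ((hval i hi y hyi).trans (hval j hj y hyj).symm)
    refine h.index_unique hi hj hyi ?_
    exact (congrArg (· ∈ Set.Ico (c j) (c (j + 1))) heq).mpr hyj
  · intro y hy
    obtain ⟨x, hx, rfl⟩ := hbij.surjOn (hsub hy)
    obtain ⟨i, hi, hxi⟩ := h.exists_mem_Ico hx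
    refine ⟨i, hi, ?_⟩
    rw [Set.mem_preimage, htr i hi x hxi]
    simpa using hxi

theorem SAF_eq_sum_volumeReal (h : IsIETData f n c t) :
    SAF n c t =
      ∑ i ∈ Finset.range n, volume.real (Set.Ico (c i) (c (i + 1))) ⊗ₜ[ℚ] t i := by
  refine Finset.sum_congr rfl fun i hi => ?_
  rw [Real.volume_real_Ico_of_le (h.2.2.2.1 i (Finset.mem_range.1 hi)).le]

theorem SAF_comp {g : ℝ → ℝ} {m l : ℕ} {d s e r : ℕ → ℝ} (hf : IsIETData f n c t)
    (hg : IsIETData g m d s) (hfg : IsIETData (f ∘ g) l e r) :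
    SAF l e r = SAF n c t + SAF m d s := by
  set B : ℕ → ℕ → ℕ → Set ℝ := fun i j k =>
    Set.Ico 0 1 ∩ g ⁻¹' Set.Ico (c i) (c (i + 1)) ∩ Set.Ico (d j) (d (j + 1)) ∩
      Set.Ico (e k) (e (k + 1)) with hB
  have hpre : ∀ i, MeasurableSet (Set.Ico 0 1 ∩ g ⁻¹' Set.Ico (c i) (c (i + 1))) :=
    fun i => hg.measurableSet_inter_preimage measurableSet_Ico
  have hF : ∀ i ∈ Finset.range n, volume.real (Set.Ico (c i) (c (i + 1))) =
      ∑ j ∈ Finset.range m, ∑ k ∈ Finset.range l, volume.real (B i j k) := by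
    intro i hi
    rw [← hg.volumeReal_inter_preimage measurableSet_Ico
      (hf.Ico_subset (Finset.mem_range.1 hi)),
      hg.volumeReal_eq_sum (hpre i) Set.inter_subset_left]
    exact Finset.sum_congr rfl fun j _ =>
      hfg.volumeReal_eq_sum ((hpre i).inter measurableSet_Ico)
        (Set.inter_subset_left.trans Set.inter_subset_left)
  have hcut : ∀ T ⊆ Set.Ico (0 : ℝ) 1, MeasurableSet T → volume.real T =
      ∑ i ∈ Finset.range n,
        volume.real (Set.Ico 0 1 ∩ g ⁻¹' Set.Ico (c i) (c (i + 1)) ∩ T) := by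
    intro T hT hTm
    rw [measureReal_eq_sum_inter (n := n) (fun i _ => hpre i) hTm
      (measure_ne_top_of_subset hT measure_Ico_lt_top.ne)
      (fun i hi j hj x hxi hxj => hf.index_unique hi hj hxi.2 hxj.2)]
    · simp only [Set.inter_comm T]
    · intro x hx
      exact (hf.exists_mem_Ico (hg.2.2.2.2.1.mapsTo (hT hx))).imp
        fun i hi => ⟨hi.1, hT hx, hi.2⟩
  have hG : ∀ j ∈ Finset.range m, volume.real (Set.Ico (d j) (d (j + 1))) =
      ∑ i ∈ Finset.range n, ∑ k ∈ Finset.range l, volume.real (B i j k) := by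
    intro j hj
    rw [hcut _ (hg.Ico_subset (Finset.mem_range.1 hj)) measurableSet_Ico]
    exact Finset.sum_congr rfl fun i _ =>
      hfg.volumeReal_eq_sum ((hpre i).inter measurableSet_Ico)
        (Set.inter_subset_left.trans Set.inter_subset_left)
  have hE : ∀ k ∈ Finset.range l, volume.real (Set.Ico (e k) (e (k + 1))) =
      ∑ i ∈ Finset.range n, ∑ j ∈ Finset.range m, volume.real (B i j k) := by
    intro k hk
    rw [hcut _ (hfg.Ico_subset (Finset.mem_range.1 hk)) measurableSet_Ico]
    refine Finset.sum_congr rfl fun i _ => ?_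
    rw [hg.volumeReal_eq_sum ((hpre i).inter measurableSet_Ico)
      (Set.inter_subset_left.trans Set.inter_subset_left)]
    exact Finset.sum_congr rfl fun j _ => by rw [hB, Set.inter_right_comm]
  have hval : ∀ i ∈ Finset.range n, ∀ j ∈ Finset.range m, ∀ k ∈ Finset.range l,
      volume.real (B i j k) ⊗ₜ[ℚ] r k =
        volume.real (B i j k) ⊗ₜ[ℚ] t i + volume.real (B i j k) ⊗ₜ[ℚ] s j := by
    intro i hi j hj k hk
    rw [Finset.mem_range] at hi hj hk
    rcases (B i j k).eq_empty_or_nonempty with h0 | ⟨x, ⟨⟨-, hxc⟩, hxd⟩, hxe⟩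
    · simp [h0]
    · have h1 := hf.2.2.2.2.2 i hi (g x) hxc
      have h2 := hg.2.2.2.2.2 j hj x hxd
      have h3 := hfg.2.2.2.2.2 k hk x hxe
      rw [Function.comp_apply] at h3
      rw [← TensorProduct.tmul_add, show r k = t i + s j by linarith]
  have hEsum : SAF l e r = ∑ i ∈ Finset.range n, ∑ j ∈ Finset.range m,
      ∑ k ∈ Finset.range l, volume.real (B i j k) ⊗ₜ[ℚ] r k := by
    rw [hfg.SAF_eq_sum_volumeReal, Finset.sum_congr rfl fun k hk => by rw [hE k hk]]
    simp only [TensorProduct.sum_tmul]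
    rw [Finset.sum_comm]
    exact Finset.sum_congr rfl fun i _ => Finset.sum_comm
  have hFsum : SAF n c t = ∑ i ∈ Finset.range n, ∑ j ∈ Finset.range m,
      ∑ k ∈ Finset.range l, volume.real (B i j k) ⊗ₜ[ℚ] t i := by
    rw [hf.SAF_eq_sum_volumeReal, Finset.sum_congr rfl fun i hi => by rw [hF i hi]]
    simp only [TensorProduct.sum_tmul]
  have hGsum : SAF m d s = ∑ i ∈ Finset.range n, ∑ j ∈ Finset.range m,
      ∑ k ∈ Finset.range l, volume.real (B i j k) ⊗ₜ[ℚ] s j := by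
    rw [hg.SAF_eq_sum_volumeReal, Finset.sum_congr rfl fun j hj => by rw [hG j hj]]
    simp only [TensorProduct.sum_tmul]
    exact Finset.sum_comm
  rw [hEsum, hFsum, hGsum]
  simp only [← Finset.sum_add_distrib]
  exact Finset.sum_congr rfl fun i hi => Finset.sum_congr rfl fun j hj =>
    Finset.sum_congr rfl fun k hk => hval i hi j hj k hk

end IsIETData

/-- The elements of a finite set `P ⊆ [0,1]` containing `0` and `1`, listed in order. -/
theorem exists_partition_of_finset {P : Finset ℝ} (hP : ∀ x ∈ P, x ∈ Set.Icc (0 : ℝ) 1)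
    (h0 : (0 : ℝ) ∈ P) (h1 : (1 : ℝ) ∈ P) :
    ∃ (l : ℕ) (e : ℕ → ℝ), 0 < l ∧ e 0 = 0 ∧ e l = 1 ∧ (∀ i < l, e i < e (i + 1)) ∧
      ∀ i < l, ∀ p ∈ P, p ∉ Set.Ioo (e i) (e (i + 1)) := by
  obtain ⟨l, hl⟩ : ∃ l, P.card = l + 1 :=
    Nat.exists_eq_succ_of_ne_zero (Finset.card_ne_zero_of_mem h0)
  set o := P.orderEmbOfFin hl
  have hmem : ∀ i, o i ∈ P := P.orderEmbOfFin_mem hl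
  have hsurj : ∀ p ∈ P, ∃ i, o i = p := fun p hp => by
    rwa [← Set.mem_range, P.range_orderEmbOfFin hl]
  obtain ⟨i₀, hi₀⟩ := hsurj 0 h0
  obtain ⟨i₁, hi₁⟩ := hsurj 1 h1
  have hfirst : o 0 = 0 :=
    le_antisymm (hi₀ ▸ o.monotone (Fin.zero_le i₀)) (hP _ (hmem 0)).1
  have hlast : o (Fin.last l) = 1 :=
    le_antisymm (hP _ (hmem _)).2 (hi₁ ▸ o.monotone (Fin.le_last i₁))
  have hofNat : ∀ i (hi : i < l + 1), Fin.ofNat (l + 1) i = ⟨i, hi⟩ := fun i hi =>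
    Fin.ext (Nat.mod_eq_of_lt hi)
  refine ⟨l, fun i => o (Fin.ofNat (l + 1) i), ?_, hfirst, ?_, fun i hi => ?_,
    fun i hi p hp hpi => ?_⟩
  · rcases Nat.eq_zero_or_pos l with rfl | hl0
    · exact absurd (hfirst.symm.trans hlast) zero_ne_one
    · exact hl0
  · simp only [hofNat l (by omega)]
    exact hlast
  · simp only [hofNat i (by omega), hofNat (i + 1) (by omega)]
    exact o.strictMono (Nat.lt_succ_self i)
  · simp only [hofNat i (by omega), hofNat (i + 1) (by omega)] at hpi
    obtain ⟨j, rfl⟩ := hsurj p hp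
    have hlt := o.lt_iff_lt.1 hpi.1
    have hgt := o.lt_iff_lt.1 hpi.2
    rw [Fin.lt_def] at hlt hgt
    simp only at hlt hgt
    omega

theorem IsIETData.exists_comp {f g : ℝ → ℝ} {n m : ℕ} {c t d s : ℕ → ℝ}
    (hf : IsIETData f n c t) (hg : IsIETData g m d s) :
    ∃ (l : ℕ) (e r : ℕ → ℝ), IsIETData (f ∘ g) l e r := by
  classical
  let P : Finset ℝ := (({0, 1} ∪ (Finset.range m).image d) ∪
    (Finset.range n ×ˢ Finset.range m).image fun q => c q.1 - s q.2).filter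
      fun x => x ∈ Set.Icc (0 : ℝ) 1
  obtain ⟨l, e, hl, he0, he1, he, hP⟩ := exists_partition_of_finset (P := P)
    (fun x hx => (Finset.mem_filter.1 hx).2) (by simp [P]) (by simp [P])
  have hmono : ∀ i j, i ≤ j → j ≤ l → e i ≤ e j := fun i j hij => by
    induction j, hij using Nat.le_induction with
    | base => exact fun _ => le_rfl
    | succ k _ ih => exact fun hk => (ih (by omega)).trans (he k (by omega)).le
  refine ⟨l, e, fun k => f (g (e k)) - e k, hl, he0, he1, he,
    hf.2.2.2.2.1.comp hg.2.2.2.2.1, fun k hk x hx => ?_⟩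
  have hk0 : 0 ≤ e k := he0 ▸ hmono 0 k (by omega) (by omega)
  have hk1 : e (k + 1) ≤ 1 := he1 ▸ hmono (k + 1) l (by omega) le_rfl
  have hxI : x ∈ Set.Ico (0 : ℝ) 1 := ⟨hk0.trans hx.1, hx.2.trans_le hk1⟩
  have hkI : e k ∈ Set.Ico (0 : ℝ) 1 := ⟨hk0, (he k hk).trans_le hk1⟩
  have hsep : ∀ p, p ∈ ({0, 1} ∪ (Finset.range m).image d) ∪
      ((Finset.range n ×ˢ Finset.range m).image fun q => c q.1 - s q.2) →
      p ≤ x → p ≤ e k := fun p hp hpx => by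
    by_contra! hlt
    exact hP k hk p (Finset.mem_filter.2
      ⟨hp, hk0.trans hlt.le, hpx.trans hxI.2.le⟩) ⟨hlt, hpx.trans_lt hx.2⟩
  obtain ⟨j, hj, hxj⟩ := hg.exists_mem_Ico hxI
  have hej : d j ≤ e k := hsep _ (Finset.mem_union_left _ <| Finset.mem_union_right _ <|
    Finset.mem_image_of_mem d (Finset.mem_range.2 hj)) hxj.1
  have hgx := hg.2.2.2.2.2 j hj x hxj
  have hge := hg.2.2.2.2.2 j hj (e k) ⟨hej, hx.1.trans_lt hxj.2⟩
  obtain ⟨i, hi, hxi⟩ := hf.exists_mem_Ico (hg.2.2.2.2.1.mapsTo hxI)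
  have hei : c i - s j ≤ e k := hsep _ (Finset.mem_union_right _ <|
    Finset.mem_image.2 ⟨(i, j), by simp [hi, hj], rfl⟩) (by linarith [hxi.1])
  have hfx := hf.2.2.2.2.2 i hi (g x) hxi
  have hfe := hf.2.2.2.2.2 i hi (g (e k)) ⟨by linarith, by linarith [hxi.2, hx.1]⟩
  rw [Function.comp_apply]
  linarith

/-- The SAF invariant is a homomorphism: if `f` and `g` are interval exchange
transformations of `[0,1)` then so is `f ∘ g`, and for any presenting data of `f`, `g` and
`f ∘ g` one has `Inv(f ∘ g) = Inv(f) + Inv(g)` in `ℝ ⊗_ℚ ℝ` (in particular the invariant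
does not depend on the choice of presenting data). -/
theorem SAF_hom (f g : ℝ → ℝ) (n : ℕ) (c t : ℕ → ℝ) (m : ℕ) (d s : ℕ → ℝ)
    (hf : IsIETData f n c t) (hg : IsIETData g m d s) :
    (∃ (l : ℕ) (e r : ℕ → ℝ), IsIETData (f ∘ g) l e r) ∧
    ∀ (l : ℕ) (e r : ℕ → ℝ), IsIETData (f ∘ g) l e r →
      SAF l e r = SAF n c t + SAF m d s := by
  exact ⟨hf.exists_comp hg, fun _ _ _ hfg => hf.SAF_comp hg hfg⟩
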